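/- For two disjoint smooth loops γ₁, γ₂ : [0,1] → ℝ³, the Gauss integral (1/4π) ∫₀¹∫₀¹ det(γ̇₁(u), γ̇₂(v), γ₁(u) - γ₂(v)) / |γ₁(u) - γ₂(v)|³ du dv is an integer. -/

import Mathlib

open MeasureTheory intervalIntegral Real

/-- The coefficient of a primitive (a Dirac monopole potential) of the solid angle form on `ℝ³`,
evaluated at the point `w` on the tangent vector `p`. It is regular where `0 < ‖w‖ + ε * w 2`. -/
noncomputable def monopole (ε : ℝ) (w p : EuclideanSpace ℝ (Fin 3)) : ℝ :=
  ε * (w 0 * p 1 - w 1 * p 0) / (‖w‖ * (‖w‖ + ε * w 2))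

/-- The derivative of `fun w ↦ monopole ε w p` at `w` in the direction `a`. -/
noncomputable def monopoleDeriv (ε : ℝ) (w p a : EuclideanSpace ℝ (Fin 3)) : ℝ :=
  (ε * (a 0 * p 1 - a 1 * p 0) * (‖w‖ * (‖w‖ + ε * w 2)) -
    ε * (w 0 * p 1 - w 1 * p 0) *
      ((w 0 * a 0 + w 1 * a 1 + w 2 * a 2) / ‖w‖ * (‖w‖ + ε * w 2) +
        ‖w‖ * ((w 0 * a 0 + w 1 * a 1 + w 2 * a 2) / ‖w‖ + ε * a 2))) /
    (‖w‖ * (‖w‖ + ε * w 2)) ^ 2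

theorem ne_zero_of_norm_add_pos {ε : ℝ} {w : EuclideanSpace ℝ (Fin 3)}
    (h : 0 < ‖w‖ + ε * w 2) : w ≠ 0 := by
  rintro rfl
  simp at h

theorem norm_sq_eq_three (w : EuclideanSpace ℝ (Fin 3)) :
    ‖w‖ ^ 2 = w 0 ^ 2 + w 1 ^ 2 + w 2 ^ 2 := by
  rw [EuclideanSpace.real_norm_sq_eq, Fin.sum_univ_three]

theorem HasDerivAt.euclidean_apply {w : ℝ → EuclideanSpace ℝ (Fin 3)}
    {a : EuclideanSpace ℝ (Fin 3)} {t : ℝ} (h : HasDerivAt w a t) (i : Fin 3) :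
    HasDerivAt (fun s => w s i) (a i) t :=
  (EuclideanSpace.proj (𝕜 := ℝ) i).hasFDerivAt.comp_hasDerivAt t h

theorem HasDerivAt.norm_three {w : ℝ → EuclideanSpace ℝ (Fin 3)}
    {a : EuclideanSpace ℝ (Fin 3)} {t : ℝ} (h : HasDerivAt w a t) (h0 : w t ≠ 0) :
    HasDerivAt (fun s => ‖w s‖) ((w t 0 * a 0 + w t 1 * a 1 + w t 2 * a 2) / ‖w t‖) t := by
  have h1 := h.norm_sq.sqrt (by simpa using h0)
  simp only [Real.sqrt_sq (norm_nonneg _)] at h1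
  convert h1 using 1
  simp only [PiLp.inner_apply, Fin.sum_univ_three, RCLike.inner_apply, conj_trivial]
  have : ‖w t‖ ≠ 0 := norm_ne_zero_iff.2 h0
  field_simp

theorem HasDerivAt.monopole {ε : ℝ} {w : ℝ → EuclideanSpace ℝ (Fin 3)}
    {a : EuclideanSpace ℝ (Fin 3)} {t : ℝ} (h : HasDerivAt w a t)
    (h0 : 0 < ‖w t‖ + ε * w t 2) (p : EuclideanSpace ℝ (Fin 3)) :
    HasDerivAt (fun s => monopole ε (w s) p) (monopoleDeriv ε (w t) p a) t := by
  have hw := ne_zero_of_norm_add_pos h0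
  have hn := h.norm_three hw
  have hnum := (((h.euclidean_apply 0).mul_const (p 1)).sub
    ((h.euclidean_apply 1).mul_const (p 0))).const_mul ε
  have hden := hn.mul (hn.add ((h.euclidean_apply 2).const_mul ε))
  exact hnum.div hden (mul_ne_zero (norm_ne_zero_iff.2 hw) h0.ne')

/-- The exterior derivative of the monopole potential is the solid angle form. -/
theorem monopoleDeriv_sub_monopoleDeriv {ε : ℝ} (hε : ε ^ 2 = 1)
    {w : EuclideanSpace ℝ (Fin 3)} (h0 : 0 < ‖w‖ + ε * w 2) (a p : EuclideanSpace ℝ (Fin 3)) :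
    monopoleDeriv ε w p a - monopoleDeriv ε w a p =
      (a 0 * (p 1 * w 2 - p 2 * w 1) - a 1 * (p 0 * w 2 - p 2 * w 0) +
        a 2 * (p 0 * w 1 - p 1 * w 0)) / ‖w‖ ^ 3 := by
  have hr : ‖w‖ ≠ 0 := norm_ne_zero_iff.2 (ne_zero_of_norm_add_pos h0)
  have hs := norm_sq_eq_three w
  have h1 := h0.ne'
  unfold monopoleDeriv
  generalize ‖w‖ = r at *
  generalize w 0 = x at *
  generalize w 1 = y at *
  generalize w 2 = z at *
  field_simp
  rcases (by simpa using hε : ε = 1 ∨ ε = -1) with rfl | rfl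
  · linear_combination (a 0 * p 1 - a 1 * p 0) * (2 * r + z) * hs
  · linear_combination -(a 0 * p 1 - a 1 * p 0) * (2 * r - z) * hs

theorem DifferentiableAt.monopole {E : Type*} [NormedAddCommGroup E] [NormedSpace ℝ E] {ε : ℝ}
    {w p : E → EuclideanSpace ℝ (Fin 3)} {q : E} (hw : DifferentiableAt ℝ w q)
    (hp : DifferentiableAt ℝ p q) (h0 : 0 < ‖w q‖ + ε * w q 2) :
    DifferentiableAt ℝ (fun q => monopole ε (w q) (p q)) q := by
  have hw0 := ne_zero_of_norm_add_pos h0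
  have h1 := differentiableAt_euclidean.1 hw
  have h2 := differentiableAt_euclidean.1 hp
  have h3 := hw.norm ℝ hw0
  have hne : ‖w q‖ * (‖w q‖ + ε * w q 2) ≠ 0 := mul_ne_zero (norm_ne_zero_iff.2 hw0) h0.ne'
  simp only [_root_.monopole, div_eq_mul_inv]
  exact ((((h1 0).mul (h2 1)).sub ((h1 1).mul (h2 0))).const_mul ε).mul
    ((h3.fun_mul (h3.fun_add ((h1 2).const_mul ε))).fun_inv hne)

/-- The angle in the `xy`-plane swept out by a path avoiding the `z`-axis. -/
theorem arg_sub_arg_eq_integral {ζ ζ' : ℝ → ℂ} {a b : ℝ} (hab : a ≤ b)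
    (hζ : ∀ t, HasDerivAt ζ (ζ' t) t) (hζ' : Continuous ζ')
    (h0 : ∀ t ∈ Set.Icc a b, ζ t ≠ 0) :
    (((ζ b).arg : Real.Angle) - ((ζ a).arg : Real.Angle)) =
      ((∫ t in a..b, (ζ' t / ζ t).im : ℝ) : Real.Angle) := by
  have hc : Continuous ζ := continuous_iff_continuousAt.2 fun t => (hζ t).continuousAt
  have hopen : IsOpen {t | ζ t ≠ 0} := isOpen_ne_fun hc continuous_const
  have hcont : ContinuousOn (fun t => ζ' t / ζ t) {t | ζ t ≠ 0} :=
    hζ'.continuousOn.div hc.continuousOn fun t ht => ht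
  have hIntegrable : ∀ t ∈ Set.Icc a b, IntervalIntegrable (fun t => ζ' t / ζ t) volume a t := by
    intro t ht
    refine (hcont.mono fun s hs => ?_).intervalIntegrable
    rw [Set.uIcc_of_le ht.1] at hs
    exact h0 s ⟨hs.1, hs.2.trans ht.2⟩
  have hd : ∀ t ∈ Set.Icc a b,
      HasDerivAt (fun t => Complex.exp (-∫ s in a..t, ζ' s / ζ s) * ζ t) 0 t := by
    intro t ht
    have h1 := integral_hasDerivAt_right (hIntegrable t ht)
      (hcont.stronglyMeasurableAtFilter hopen t (h0 t ht))
      (hcont.continuousAt (hopen.mem_nhds (h0 t ht)))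
    refine (h1.fun_neg.cexp.fun_mul (hζ t)).congr_deriv ?_
    have := h0 t ht
    field_simp
    ring
  have hconst := constant_of_has_deriv_right_zero
    (fun t ht => (hd t ht).continuousAt.continuousWithinAt)
    (fun t ht => (hd t ⟨ht.1, ht.2.le⟩).hasDerivWithinAt) b ⟨hab, le_rfl⟩
  simp only [integral_same, neg_zero, Complex.exp_zero, one_mul] at hconst
  set J := ∫ s in a..b, ζ' s / ζ s with hJ
  have hb : ζ b = Complex.exp J * ζ a := by
    rw [← hconst, ← mul_assoc, ← Complex.exp_add]
    simp
  have him : ∫ t in a..b, (ζ' t / ζ t).im = J.im :=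
    Complex.imCLM.intervalIntegral_comp_comm (hIntegrable b ⟨hab, le_rfl⟩)
  rw [him, hb, Complex.arg_mul_coe_angle (Complex.exp_ne_zero _) (h0 a ⟨le_rfl, hab⟩),
    add_sub_cancel_right]
  rw [Complex.arg_exp, Real.Angle.coe_toIocMod]

/-- The orthogonal projection of a vector to the `xy`-plane, as a complex number. -/
noncomputable def planePart (w : EuclideanSpace ℝ (Fin 3)) : ℂ := w 0 + w 1 * Complex.I

/-- Half the parallel transport angle of the monopole connection along the path `w` on `[a, b]`,
corrected by a change of gauge so that it does not depend on the sign `ε`. -/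
noncomputable def transport (ε : ℝ) (w : ℝ → EuclideanSpace ℝ (Fin 3)) (a b : ℝ) : Real.Angle :=
  (((∫ t in a..b, monopole ε (w t) (deriv w t)) / 2 : ℝ) : Real.Angle) +
    if 0 < ε then 0 else
      (((planePart (w b)).arg : Real.Angle) - ((planePart (w a)).arg : Real.Angle))

theorem planePart_im_div {w p : EuclideanSpace ℝ (Fin 3)} (h1 : 0 < ‖w‖ + 1 * w 2)
    (h2 : 0 < ‖w‖ + (-1) * w 2) :
    planePart w ≠ 0 ∧
      (planePart p / planePart w).im = monopole 1 w p / 2 - monopole (-1) w p / 2 := by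
  have hr : ‖w‖ ≠ 0 := norm_ne_zero_iff.2 (ne_zero_of_norm_add_pos h1)
  have hs := norm_sq_eq_three w
  have hpos : 0 < w 0 ^ 2 + w 1 ^ 2 := by nlinarith [mul_pos h1 h2]
  have hnorm : Complex.normSq (planePart w) = w 0 ^ 2 + w 1 ^ 2 := by
    simp [planePart, Complex.normSq_apply, sq]
  refine ⟨fun h => ?_, ?_⟩
  · rw [h, map_zero] at hnorm
    exact hpos.ne hnorm
  · rw [Complex.div_im, hnorm]
    simp only [planePart, monopole, Complex.add_re, Complex.add_im, Complex.ofReal_re,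
      Complex.ofReal_im, Complex.mul_re, Complex.mul_im, Complex.I_re, Complex.I_im]
    generalize ‖w‖ = r at *
    generalize w 0 = x at *
    generalize w 1 = y at *
    generalize w 2 = z at *
    have h1' : r + z ≠ 0 := by linarith
    have h2' : r - z ≠ 0 := by linarith
    rw [show x ^ 2 + y ^ 2 = (r + z) * (r - z) by linear_combination -hs, one_mul,
      neg_one_mul z, ← sub_eq_add_neg]
    field_simp
    ring

theorem intervalIntegrable_monopole {ε : ℝ} {w : ℝ → EuclideanSpace ℝ (Fin 3)} {a b : ℝ}
    (hw : ContDiff ℝ 2 w) (hab : a ≤ b) (h : ∀ t ∈ Set.Icc a b, 0 < ‖w t‖ + ε * w t 2) :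
    IntervalIntegrable (fun t => monopole ε (w t) (deriv w t)) volume a b := by
  refine ContinuousOn.intervalIntegrable fun t ht => ?_
  rw [Set.uIcc_of_le hab] at ht
  exact ((hw.differentiable (by norm_num) t).monopole
    ((hw.deriv' (n := 1)).differentiable (by norm_num) t) (h t ht)).continuousAt.continuousWithinAt

theorem transport_one_eq_transport_neg_one {w : ℝ → EuclideanSpace ℝ (Fin 3)} {a b : ℝ}
    (hw : ContDiff ℝ 2 w) (hab : a ≤ b) (h1 : ∀ t ∈ Set.Icc a b, 0 < ‖w t‖ + 1 * w t 2)
    (h2 : ∀ t ∈ Set.Icc a b, 0 < ‖w t‖ + (-1) * w t 2) :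
    transport 1 w a b = transport (-1) w a b := by
  have hd : ∀ t, HasDerivAt w (deriv w t) t := fun t =>
    (hw.differentiable (by norm_num) t).hasDerivAt
  have hc : Continuous (deriv w) := (hw.deriv' (n := 1)).continuous
  have hζ : ∀ t, HasDerivAt (fun t => planePart (w t)) (planePart (deriv w t)) t := fun t =>
    ((hd t).euclidean_apply 0).ofReal_comp.add
      (((hd t).euclidean_apply 1).ofReal_comp.mul_const Complex.I)
  have key := arg_sub_arg_eq_integral hab hζ (by unfold planePart; fun_prop)
    (fun t ht => (planePart_im_div (p := 0) (h1 t ht) (h2 t ht)).1)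
  have hIntegrable : ∫ t in a..b, (planePart (deriv w t) / planePart (w t)).im =
      (∫ t in a..b, monopole 1 (w t) (deriv w t)) / 2 -
        (∫ t in a..b, monopole (-1) (w t) (deriv w t)) / 2 := by
    rw [← intervalIntegral.integral_div, ← intervalIntegral.integral_div,
      ← intervalIntegral.integral_sub
      ((intervalIntegrable_monopole hw hab h1).div_const 2)
      ((intervalIntegrable_monopole hw hab h2).div_const 2)]
    refine integral_congr fun t ht => ?_
    rw [Set.uIcc_of_le hab] at ht
    exact (planePart_im_div (h1 t ht) (h2 t ht)).2
  unfold transport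
  rw [if_pos one_pos, if_neg (by norm_num), key, hIntegrable, ← Real.Angle.coe_add, add_zero]
  congr 1
  ring

open Classical in
/-- The transport angle along a path, computed in whichever gauge is regular. -/
noncomputable def edgeAngle (w : ℝ → EuclideanSpace ℝ (Fin 3)) (a b : ℝ) : Real.Angle :=
  if ∀ t ∈ Set.Icc a b, 0 < ‖w t‖ + 1 * w t 2 then transport 1 w a b else transport (-1) w a b

theorem edgeAngle_eq_transport {ε : ℝ} (hε : ε = 1 ∨ ε = -1)
    {w : ℝ → EuclideanSpace ℝ (Fin 3)} {a b : ℝ} (hw : ContDiff ℝ 2 w) (hab : a ≤ b)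
    (h : ∀ t ∈ Set.Icc a b, 0 < ‖w t‖ + ε * w t 2) : edgeAngle w a b = transport ε w a b := by
  unfold edgeAngle
  rcases hε with rfl | rfl
  · rw [if_pos h]
  · split_ifs with h1
    · exact transport_one_eq_transport_neg_one hw hab h1 h
    · rfl

/-- The integrand of the Gauss linking integral. -/
noncomputable def gaussIntegrand (γ₁ γ₂ : ℝ → EuclideanSpace ℝ (Fin 3)) (u v : ℝ) : ℝ :=
  (Matrix.of fun i j =>
    (![deriv γ₁ u, deriv γ₂ v, γ₁ u - γ₂ v] : Fin 3 → EuclideanSpace ℝ (Fin 3)) i j).det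
  / ‖γ₁ u - γ₂ v‖ ^ 3

theorem gaussIntegrand_eq {ε : ℝ} (hε : ε ^ 2 = 1) {γ₁ γ₂ : ℝ → EuclideanSpace ℝ (Fin 3)}
    {u v : ℝ} (h : 0 < ‖γ₁ u - γ₂ v‖ + ε * (γ₁ u - γ₂ v) 2) :
    gaussIntegrand γ₁ γ₂ u v =
      -monopoleDeriv ε (γ₁ u - γ₂ v) (-deriv γ₂ v) (deriv γ₁ u) +
        monopoleDeriv ε (γ₁ u - γ₂ v) (deriv γ₁ u) (-deriv γ₂ v) := by
  have := monopoleDeriv_sub_monopoleDeriv hε h (deriv γ₁ u) (-deriv γ₂ v)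
  rw [neg_add_eq_sub, ← neg_sub, this, gaussIntegrand, Matrix.det_fin_three, ← neg_div]
  congr 1
  simp only [Matrix.of_apply, Matrix.cons_val, PiLp.neg_apply]
  ring

theorem continuousAt_gaussIntegrand {γ₁ γ₂ : ℝ → EuclideanSpace ℝ (Fin 3)}
    (h₁ : ContDiff ℝ 2 γ₁) (h₂ : ContDiff ℝ 2 γ₂) {q : ℝ × ℝ} (h : γ₁ q.1 ≠ γ₂ q.2) :
    ContinuousAt (fun q : ℝ × ℝ => gaussIntegrand γ₁ γ₂ q.1 q.2) q := by
  have c1 := h₁.continuous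
  have c2 := h₂.continuous
  have c3 : Continuous (deriv γ₁) := (h₁.deriv' (n := 1)).continuous
  have c4 : Continuous (deriv γ₂) := (h₂.deriv' (n := 1)).continuous
  refine ContinuousAt.div (Continuous.continuousAt ?_) (Continuous.continuousAt ?_) ?_
  · simp only [Matrix.det_fin_three, Matrix.of_apply, Matrix.cons_val]
    fun_prop
  · fun_prop
  · simpa [sub_eq_zero] using h

/-- Stokes' theorem for the Gauss integrand on a rectangle where the gauge `ε` is regular. -/
theorem integral_gaussIntegrand_rectangle {ε : ℝ} (hε : ε ^ 2 = 1)
    {γ₁ γ₂ : ℝ → EuclideanSpace ℝ (Fin 3)} (h₁ : ContDiff ℝ 2 γ₁) (h₂ : ContDiff ℝ 2 γ₂)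
    {a b c d : ℝ} (hab : a ≤ b) (hcd : c ≤ d)
    (h : ∀ u ∈ Set.Icc a b, ∀ v ∈ Set.Icc c d, 0 < ‖γ₁ u - γ₂ v‖ + ε * (γ₁ u - γ₂ v) 2) :
    ∫ u in a..b, ∫ v in c..d, gaussIntegrand γ₁ γ₂ u v =
      (∫ u in a..b, monopole ε (γ₁ u - γ₂ d) (deriv γ₁ u)) -
        (∫ u in a..b, monopole ε (γ₁ u - γ₂ c) (deriv γ₁ u)) -
        (∫ v in c..d, monopole ε (γ₁ b - γ₂ v) (-deriv γ₂ v)) +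
        ∫ v in c..d, monopole ε (γ₁ a - γ₂ v) (-deriv γ₂ v) := by
  set f : ℝ × ℝ → ℝ := fun q => -monopole ε (γ₁ q.1 - γ₂ q.2) (-deriv γ₂ q.2) with hf
  set g : ℝ × ℝ → ℝ := fun q => monopole ε (γ₁ q.1 - γ₂ q.2) (deriv γ₁ q.1) with hg
  have d1 : Differentiable ℝ γ₁ := h₁.differentiable (by norm_num)
  have d2 : Differentiable ℝ γ₂ := h₂.differentiable (by norm_num)
  have d3 : Differentiable ℝ (deriv γ₁) := (h₁.deriv' (n := 1)).differentiable (by norm_num)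
  have d4 : Differentiable ℝ (deriv γ₂) := (h₂.deriv' (n := 1)).differentiable (by norm_num)
  have hfd : ∀ q ∈ Set.Icc a b ×ˢ Set.Icc c d, DifferentiableAt ℝ f q := fun q hq =>
    (DifferentiableAt.monopole (w := fun q : ℝ × ℝ => γ₁ q.1 - γ₂ q.2)
      (p := fun q : ℝ × ℝ => -deriv γ₂ q.2) (by fun_prop) (by fun_prop)
      (h q.1 hq.1 q.2 hq.2)).neg
  have hgd : ∀ q ∈ Set.Icc a b ×ˢ Set.Icc c d, DifferentiableAt ℝ g q := fun q hq =>
    DifferentiableAt.monopole (w := fun q : ℝ × ℝ => γ₁ q.1 - γ₂ q.2)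
      (p := fun q : ℝ × ℝ => deriv γ₁ q.1) (by fun_prop) (by fun_prop) (h q.1 hq.1 q.2 hq.2)
  have heq : ∀ q ∈ Set.Icc a b ×ˢ Set.Icc c d,
      fderiv ℝ f q (1, 0) + fderiv ℝ g q (0, 1) = gaussIntegrand γ₁ γ₂ q.1 q.2 := by
    rintro ⟨u, v⟩ hq
    have hp := h u hq.1 v hq.2
    rw [gaussIntegrand_eq hε hp]
    congr 1
    · have hs := (hfd _ hq).hasFDerivAt.comp_hasDerivAt u
        ((hasDerivAt_id u).prodMk (hasDerivAt_const u v))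
      exact hs.unique
        (((d1 u).hasDerivAt.sub_const (γ₂ v)).monopole hp (-deriv γ₂ v)).fun_neg
    · have hs := (hgd _ hq).hasFDerivAt.comp_hasDerivAt v
        ((hasDerivAt_const v u).prodMk (hasDerivAt_id v))
      exact hs.unique (((d2 v).hasDerivAt.const_sub (γ₁ u)).monopole hp (deriv γ₁ u))
  have key := integral2_divergence_prod_of_hasFDerivAt f g (fderiv ℝ f) (fderiv ℝ g) a c b d
  simp only [Set.uIcc_of_le hab, Set.uIcc_of_le hcd, min_eq_left hab, max_eq_right hab,
    min_eq_left hcd, max_eq_right hcd] at key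
  have hsub : Set.Ioo a b ×ˢ Set.Ioo c d ⊆ Set.Icc a b ×ˢ Set.Icc c d :=
    Set.prod_mono Set.Ioo_subset_Icc_self Set.Ioo_subset_Icc_self
  specialize key (fun q hq => (hfd q hq).continuousAt.continuousWithinAt)
    (fun q hq => (hgd q hq).continuousAt.continuousWithinAt)
    (fun q hq => (hfd q (hsub hq)).hasFDerivAt) (fun q hq => (hgd q (hsub hq)).hasFDerivAt) ?_
  · refine IntegrableOn.congr_fun (ContinuousOn.integrableOn_compact
      (isCompact_Icc.prod isCompact_Icc) fun q hq => ?_) (fun q hq => (heq q hq).symm)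
      (measurableSet_Icc.prod measurableSet_Icc)
    exact (continuousAt_gaussIntegrand h₁ h₂ (sub_ne_zero.1 (ne_zero_of_norm_add_pos
      (h q.1 hq.1 q.2 hq.2)))).continuousWithinAt
  · have hl : ∫ u in a..b, ∫ v in c..d, gaussIntegrand γ₁ γ₂ u v =
        ∫ u in a..b, ∫ v in c..d, fderiv ℝ f (u, v) (1, 0) + fderiv ℝ g (u, v) (0, 1) := by
      refine integral_congr fun u hu => integral_congr fun v hv => ?_
      rw [Set.uIcc_of_le hab] at hu
      rw [Set.uIcc_of_le hcd] at hv
      exact (heq (u, v) ⟨hu, hv⟩).symm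
    rw [hl, key]
    simp only [hf, hg, intervalIntegral.integral_neg]
    ring

/-- On a rectangle where some gauge is regular, half the Gauss integral is the sum of the edge
angles along the boundary. -/
theorem gaussIntegral_rectangle_angle {ε : ℝ} (hε : ε = 1 ∨ ε = -1)
    {γ₁ γ₂ : ℝ → EuclideanSpace ℝ (Fin 3)} (h₁ : ContDiff ℝ 2 γ₁) (h₂ : ContDiff ℝ 2 γ₂)
    {a b c d : ℝ} (hab : a ≤ b) (hcd : c ≤ d)
    (h : ∀ u ∈ Set.Icc a b, ∀ v ∈ Set.Icc c d, 0 < ‖γ₁ u - γ₂ v‖ + ε * (γ₁ u - γ₂ v) 2) :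
    (((∫ u in a..b, ∫ v in c..d, gaussIntegrand γ₁ γ₂ u v) / 2 : ℝ) : Real.Angle) =
      (edgeAngle (fun u => γ₁ u - γ₂ d) a b - edgeAngle (fun u => γ₁ u - γ₂ c) a b) -
        (edgeAngle (fun v => γ₁ b - γ₂ v) c d - edgeAngle (fun v => γ₁ a - γ₂ v) c d) := by
  have hε2 : ε ^ 2 = 1 := by rcases hε with rfl | rfl <;> norm_num
  rw [integral_gaussIntegrand_rectangle hε2 h₁ h₂ hab hcd h,
    edgeAngle_eq_transport hε (by fun_prop) hab fun u hu => h u hu d ⟨hcd, le_rfl⟩,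
    edgeAngle_eq_transport hε (by fun_prop) hab fun u hu => h u hu c ⟨le_rfl, hcd⟩,
    edgeAngle_eq_transport hε (by fun_prop) hcd fun v hv => h b ⟨hab, le_rfl⟩ v hv,
    edgeAngle_eq_transport hε (by fun_prop) hcd fun v hv => h a ⟨le_rfl, hab⟩ v hv]
  simp only [transport, deriv_sub_const_fun, deriv_const_sub, add_div, sub_div,
    Real.Angle.coe_add, Real.Angle.coe_sub]
  split_ifs
  · abel
  · abel

/-- The double integral over the unit square is the sum over the cells of a uniform grid. -/
theorem integral_unit_square_eq_sum {f : ℝ → ℝ → ℝ}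
    (hf : ContinuousOn (fun q : ℝ × ℝ => f q.1 q.2) (Set.Icc 0 1 ×ˢ Set.Icc 0 1)) {n : ℕ}
    (hn : 0 < n) :
    ∫ u in (0 : ℝ)..1, ∫ v in (0 : ℝ)..1, f u v =
      ∑ i ∈ Finset.range n, ∑ j ∈ Finset.range n,
        ∫ u in (i / n : ℝ)..((i + 1 : ℕ) / n : ℝ),
          ∫ v in (j / n : ℝ)..((j + 1 : ℕ) / n : ℝ), f u v := by
  have hn' : (0 : ℝ) < n := Nat.cast_pos.2 hn
  set g : ℝ → ℝ → ℝ := fun u v =>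
    f (Set.projIcc (0 : ℝ) 1 zero_le_one u) (Set.projIcc (0 : ℝ) 1 zero_le_one v) with hg
  have hgc : Continuous (Function.uncurry g) :=
    hf.comp_continuous (f := fun q : ℝ × ℝ => ((Set.projIcc (0 : ℝ) 1 zero_le_one q.1 : ℝ),
      (Set.projIcc (0 : ℝ) 1 zero_le_one q.2 : ℝ)))
      (by fun_prop) fun q => ⟨Subtype.mem _, Subtype.mem _⟩
  have hfg : ∀ u ∈ Set.Icc (0 : ℝ) 1, ∀ v ∈ Set.Icc (0 : ℝ) 1, f u v = g u v := by
    intro u hu v hv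
    simp only [hg, Set.projIcc_of_mem _ hu, Set.projIcc_of_mem _ hv]
  have hcell : ∀ i ∈ Finset.range n,
      Set.uIcc (i / n : ℝ) ((i + 1 : ℕ) / n : ℝ) ⊆ Set.Icc (0 : ℝ) 1 := by
    intro i hi
    have h1 : ((i + 1 : ℕ) : ℝ) ≤ n := Nat.cast_le.2 (Finset.mem_range.1 hi)
    rw [Set.uIcc_of_le (by gcongr; exact Nat.le_succ i)]
    exact Set.Icc_subset_Icc (by positivity) ((div_le_one hn').2 h1)
  have hIntegrable : ∀ a b, Continuous fun u => ∫ v in a..b, g u v := fun a b =>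
    continuous_parametric_intervalIntegral_of_continuous' hgc a b
  have hsum : ∀ h : ℝ → ℝ, Continuous h → ∫ t in (0 : ℝ)..1, h t =
      ∑ i ∈ Finset.range n, ∫ t in (i / n : ℝ)..((i + 1 : ℕ) / n : ℝ), h t := by
    intro h hh
    rw [sum_integral_adjacent_intervals (a := fun i : ℕ => (i / n : ℝ))
      fun k _ => hh.intervalIntegrable _ _]
    simp [hn'.ne']
  calc ∫ u in (0 : ℝ)..1, ∫ v in (0 : ℝ)..1, f u v
      = ∫ u in (0 : ℝ)..1, ∫ v in (0 : ℝ)..1, g u v := by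
        refine integral_congr fun u hu => integral_congr fun v hv => ?_
        rw [Set.uIcc_of_le zero_le_one] at hu hv
        exact hfg u hu v hv
    _ = ∑ i ∈ Finset.range n, ∑ j ∈ Finset.range n,
        ∫ u in (i / n : ℝ)..((i + 1 : ℕ) / n : ℝ),
          ∫ v in (j / n : ℝ)..((j + 1 : ℕ) / n : ℝ), g u v := by
        rw [hsum _ (hIntegrable 0 1)]
        refine Finset.sum_congr rfl fun i _ => ?_
        rw [← intervalIntegral.integral_finsetSum
          fun j _ => (hIntegrable _ _).intervalIntegrable _ _]
        exact integral_congr fun u _ => hsum _ (by fun_prop)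
    _ = _ := by
        refine Finset.sum_congr rfl fun i hi => Finset.sum_congr rfl fun j hj =>
          integral_congr fun u hu => integral_congr fun v hv => ?_
        exact (hfg u (hcell i hi hu) v (hcell j hj hv)).symm

/-- On a sufficiently fine grid, every cell has a regular gauge. -/
theorem exists_grid_gauge {w : ℝ × ℝ → EuclideanSpace ℝ (Fin 3)} (hw : Continuous w)
    (h0 : ∀ q ∈ Set.Icc (0 : ℝ) 1 ×ˢ Set.Icc (0 : ℝ) 1, w q ≠ 0) :
    ∃ n : ℕ, 0 < n ∧ ∀ i < n, ∀ j < n, ∃ ε : ℝ, (ε = 1 ∨ ε = -1) ∧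
      ∀ u ∈ Set.Icc (i / n : ℝ) ((i + 1 : ℕ) / n : ℝ),
        ∀ v ∈ Set.Icc (j / n : ℝ) ((j + 1 : ℕ) / n : ℝ), 0 < ‖w (u, v)‖ + ε * w (u, v) 2 := by
  obtain ⟨δ, hδ, hball⟩ := lebesgue_number_lemma_of_metric
    (s := Set.Icc (0 : ℝ) 1 ×ˢ Set.Icc (0 : ℝ) 1)
    (c := fun ε : {ε : ℝ // ε = 1 ∨ ε = -1} => {q | 0 < ‖w q‖ + ε * w q 2})
    (isCompact_Icc.prod isCompact_Icc)
    (fun ε => isOpen_lt continuous_const (by fun_prop)) (by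
      intro q hq
      have hpos := norm_pos_iff.2 (h0 q hq)
      rw [Set.mem_iUnion]
      rcases le_total 0 (w q 2) with h | h
      · exact ⟨⟨1, Or.inl rfl⟩, by simp only [Set.mem_ofPred_eq]; linarith⟩
      · exact ⟨⟨-1, Or.inr rfl⟩, by simp only [Set.mem_ofPred_eq]; linarith⟩)
  obtain ⟨m, hm⟩ := exists_nat_one_div_lt hδ
  refine ⟨m + 1, m.succ_pos, fun i hi j hj => ?_⟩
  have hm' : (0 : ℝ) < (m + 1 : ℕ) := by positivity
  have hmem : ∀ k < m + 1, (k / (m + 1 : ℕ) : ℝ) ∈ Set.Icc (0 : ℝ) 1 := fun k hk =>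
    ⟨by positivity, (div_le_one hm').2 (Nat.cast_le.2 hk.le)⟩
  obtain ⟨ε, hε⟩ := hball (i / (m + 1 : ℕ), j / (m + 1 : ℕ)) ⟨hmem i hi, hmem j hj⟩
  have hdist : ∀ k : ℕ, ∀ t ∈ Set.Icc (k / (m + 1 : ℕ) : ℝ) ((k + 1 : ℕ) / (m + 1 : ℕ) : ℝ),
      dist t (k / (m + 1 : ℕ)) < δ := by
    intro k t ht
    rw [Real.dist_eq, abs_of_nonneg (sub_nonneg.2 ht.1)]
    have := ht.2
    rw [Nat.cast_succ k, add_div] at this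
    push_cast at this hm ⊢
    linarith
  exact ⟨ε, ε.2, fun u hu v hv => hε (max_lt (hdist i u hu) (hdist j v hv))⟩

/-- A discrete curl on a grid with periodic boundary values has total sum zero. -/
theorem sum_discrete_curl_eq_zero {A : Type*} [AddCommGroup A] (H V : ℕ → ℕ → A) (n : ℕ)
    (hH : ∀ i, H i n = H i 0) (hV : ∀ j, V n j = V 0 j) :
    ∑ i ∈ Finset.range n, ∑ j ∈ Finset.range n,
      ((H i (j + 1) - H i j) - (V (i + 1) j - V i j)) = 0 := by
  have h1 : ∀ i, ∑ j ∈ Finset.range n, (H i (j + 1) - H i j) = 0 := fun i => by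
    rw [Finset.sum_range_sub, hH, sub_self]
  have h2 : ∀ j, ∑ i ∈ Finset.range n, (V (i + 1) j - V i j) = 0 := fun j => by
    rw [Finset.sum_range_sub fun i => V i j, hV, sub_self]
  simp_rw [fun i => Finset.sum_sub_distrib (s := Finset.range n)
    (fun j => H i (j + 1) - H i j) (fun j => V (i + 1) j - V i j), h1, zero_sub]
  rw [Finset.sum_neg_distrib, Finset.sum_comm]
  simp only [h2, Finset.sum_const_zero, neg_zero]

/-- The Gauss linking integral of two disjoint smooth loops in ℝ³ is an integer
(the linking number). -/
theorem stmt_10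
    (γ₁ γ₂ : ℝ → EuclideanSpace ℝ (Fin 3))
    (hγ₁ : ContDiff ℝ (⊤ : ℕ∞) γ₁) (hγ₂ : ContDiff ℝ (⊤ : ℕ∞) γ₂)
    (hloop₁ : γ₁ 0 = γ₁ 1) (hloop₂ : γ₂ 0 = γ₂ 1)
    (hder₁ : deriv γ₁ 0 = deriv γ₁ 1) (hder₂ : deriv γ₂ 0 = deriv γ₂ 1)
    (hdisj : ∀ u ∈ Set.Icc (0:ℝ) 1, ∀ v ∈ Set.Icc (0:ℝ) 1, γ₁ u ≠ γ₂ v) :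
    ∃ n : ℤ,
      (1 / (4 * π)) * ∫ u in (0:ℝ)..1, ∫ v in (0:ℝ)..1,
          (Matrix.of fun i j =>
            (![deriv γ₁ u, deriv γ₂ v, γ₁ u - γ₂ v] : Fin 3 → EuclideanSpace ℝ (Fin 3)) i j).det
          / ‖γ₁ u - γ₂ v‖ ^ 3
        = (n : ℝ) := by
  have h₁ : ContDiff ℝ 2 γ₁ := hγ₁.of_le (WithTop.coe_le_coe.2 le_top)
  have h₂ : ContDiff ℝ 2 γ₂ := hγ₂.of_le (WithTop.coe_le_coe.2 le_top)
  change ∃ n : ℤ, (1 / (4 * π)) * ∫ u in (0:ℝ)..1, ∫ v in (0:ℝ)..1, gaussIntegrand γ₁ γ₂ u v = n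
  obtain ⟨n, hn, hgauge⟩ := exists_grid_gauge (w := fun q : ℝ × ℝ => γ₁ q.1 - γ₂ q.2)
    ((h₁.continuous.comp continuous_fst).sub (h₂.continuous.comp continuous_snd))
    fun q hq => sub_ne_zero.2 (hdisj q.1 hq.1 q.2 hq.2)
  have hn' : (n : ℝ) ≠ 0 := Nat.cast_ne_zero.2 hn.ne'
  have hsum := integral_unit_square_eq_sum (f := gaussIntegrand γ₁ γ₂)
    (fun q hq => (continuousAt_gaussIntegrand h₁ h₂
      (hdisj q.1 hq.1 q.2 hq.2)).continuousWithinAt) hn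
  have hangle : (((∫ u in (0:ℝ)..1, ∫ v in (0:ℝ)..1, gaussIntegrand γ₁ γ₂ u v) / 2 : ℝ) :
      Real.Angle) = 0 := by
    rw [hsum, Finset.sum_div]
    simp only [Finset.sum_div]
    rw [← sum_discrete_curl_eq_zero
      (fun i j => edgeAngle (fun u => γ₁ u - γ₂ (j / n)) (i / n) ((i + 1 : ℕ) / n))
      (fun i j => edgeAngle (fun v => γ₁ (i / n) - γ₂ v) (j / n) ((j + 1 : ℕ) / n)) n
      (by simp [hn', hloop₂]) (by simp [hn', hloop₁])]
    have hle : ∀ i : ℕ, (i / n : ℝ) ≤ (i + 1 : ℕ) / n := fun i => by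
      gcongr
      exact Nat.le_succ i
    rw [← Real.Angle.coe_coeHom, map_sum]
    refine Finset.sum_congr rfl fun i hi => ?_
    rw [map_sum]
    refine Finset.sum_congr rfl fun j hj => ?_
    obtain ⟨ε, hε, h⟩ := hgauge i (Finset.mem_range.1 hi) j (Finset.mem_range.1 hj)
    exact gaussIntegral_rectangle_angle hε h₁ h₂ (hle i) (hle j) h
  obtain ⟨k, hk⟩ := Real.Angle.coe_eq_zero_iff.1 hangle
  refine ⟨k, ?_⟩
  rw [zsmul_eq_mul] at hk
  field_simp
  linarith
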